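/- Let ω be a free filter on ℕ and (A_k) a sequence of unital C*-algebras. If div_2(A_k) → ∞ along k (more precisely limsup_ω div_2(A_k) = ∞), then the quotient ∏_ω A_k := (∏_{k} A_k)/c_ω({A_k}) has a character, where div_2(B) = ∞ is equivalent to B having a character. -/

import Mathlib

open scoped ENNReal ComplexOrder

/-- `B` is weakly `(2,n)`-divisible: there are positive contractions `a i j`
(`i ∈ {0,1}`, `j < n`) such that `a 0 j` and `a 1 j` are orthogonal and equivalent for
each `j`, and contractions `y j` with `∑ j, (y j)* (a 0 j) (y j) = 1`.  (This is the
concrete reformulation, via Lemma 7.3(i), of the existence of `x 1, …, x n ∈ Cu(B)` with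
`2 • x j ≤ ⟨1⟩ ≤ x 1 + ⋯ + x n`.) -/
def WeaklyTwoDivisible (B : Type*) [CStarAlgebra B] [PartialOrder B] [StarOrderedRing B]
    (n : ℕ) : Prop :=
  ∃ (a : Fin 2 → Fin n → B) (y : Fin n → B),
    (∀ i j, 0 ≤ a i j ∧ ‖a i j‖ ≤ 1) ∧
    (∀ j, a 0 j * a 1 j = 0) ∧
    (∀ j, ∃ v : B, a 0 j = v * star v ∧ a 1 j = star v * v) ∧
    (∀ j, ‖y j‖ ≤ 1) ∧
    ∑ j, star (y j) * a 0 j * y j = 1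

/-- `div₂(B) ∈ ℕ ∪ {∞}`: the least `n` such that `B` is weakly `(2,n)`-divisible. -/
noncomputable def divTwo (B : Type*) [CStarAlgebra B] [PartialOrder B]
    [StarOrderedRing B] : ℕ∞ :=
  sInf ((fun n : ℕ => (n : ℕ∞)) '' {n : ℕ | WeaklyTwoDivisible B n})

namespace TwoSidedIdeal

/-- A proper two-sided ideal is contained in a maximal one. -/
theorem exists_le_maximal_one_notMem {R : Type*} [Ring R] (J : TwoSidedIdeal R)
    (hJ : (1 : R) ∉ J) : ∃ M : TwoSidedIdeal R, J ≤ M ∧ Maximal (fun I => (1 : R) ∉ I) M := by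
  refine zorn_le_nonempty₀ {I : TwoSidedIdeal R | (1 : R) ∉ I} ?_ J hJ
  intro c hc hchain I₀ hI₀
  have hdir : ∀ {x y : R}, (∃ I ∈ c, x ∈ I) → (∃ I ∈ c, y ∈ I) → ∃ I ∈ c, x ∈ I ∧ y ∈ I := by
    rintro x y ⟨I, hI, hx⟩ ⟨I', hI', hy⟩
    rcases hchain.total hI hI' with h | h
    · exact ⟨I', hI', h hx, hy⟩
    · exact ⟨I, hI, hx, h hy⟩
  refine ⟨.mk' {x | ∃ I ∈ c, x ∈ I} ⟨I₀, hI₀, I₀.zero_mem⟩ ?_ ?_ ?_ ?_, ?_, ?_⟩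
  · intro x y hx hy
    obtain ⟨I, hI, h, h'⟩ := hdir hx hy
    exact ⟨I, hI, I.add_mem h h'⟩
  · rintro x ⟨I, hI, hx⟩
    exact ⟨I, hI, I.neg_mem hx⟩
  · rintro x y ⟨I, hI, hx⟩
    exact ⟨I, hI, I.mul_mem_left _ _ hx⟩
  · rintro x y ⟨I, hI, hx⟩
    exact ⟨I, hI, I.mul_mem_right _ _ hx⟩
  · simp only [Set.mem_ofPred_eq, mem_mk', not_exists, not_and]
    exact fun I hI => hc hI
  · intro I hI x hx
    exact (mem_mk' ..).2 ⟨I, hI, hx⟩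

/-- A maximal two-sided ideal is prime. -/
theorem mem_or_mem_of_maximal {R : Type*} [Ring R] {M : TwoSidedIdeal R}
    (hM : Maximal (fun I : TwoSidedIdeal R => (1 : R) ∉ I) M) {x y : R}
    (h : ∀ l, x * l * y ∈ M) : x ∈ M ∨ y ∈ M := by
  let I : TwoSidedIdeal R := .mk' {z | ∀ l, z * l * y ∈ M}
    (by simp [M.zero_mem])
    (fun {a b} ha hb l => by simpa only [add_mul] using M.add_mem (ha l) (hb l))
    (fun {a} ha l => by simpa only [neg_mul] using M.neg_mem (ha l))
    (fun {a b} hb l => by simpa only [mul_assoc] using M.mul_mem_left a _ (hb l))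
    (fun {a b} ha l => by simpa only [mul_assoc] using ha (b * l))
  have hI : ∀ z, z ∈ I ↔ ∀ l, z * l * y ∈ M := fun z => mem_mk' ..
  have hMI : M ≤ I := fun z hz => (hI z).2 fun l => M.mul_mem_right _ _ (M.mul_mem_right _ _ hz)
  by_cases h1 : (1 : R) ∈ I
  · right
    simpa using (hI 1).1 h1 1
  · left
    exact hM.2 h1 hMI ((hI x).2 h)

/-- A maximal two-sided ideal of a Banach algebra is closed. -/
theorem isClosed_of_maximal {R : Type*} [NormedRing R] [CompleteSpace R] {M : TwoSidedIdeal R}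
    (hM : Maximal (fun I : TwoSidedIdeal R => (1 : R) ∉ I) M) : IsClosed (M : Set R) := by
  let I : TwoSidedIdeal R := .mk' (closure (M : Set R))
    (subset_closure M.zero_mem)
    (fun ha hb => map_mem_closure₂ continuous_add ha hb fun _ h _ h' => M.add_mem h h')
    (fun ha => map_mem_closure continuous_neg ha fun _ h => M.neg_mem h)
    (fun {a b} hb => map_mem_closure (continuous_const_mul a) hb fun _ h => M.mul_mem_left _ _ h)
    (fun {a b} ha => map_mem_closure (f := (· * b)) (continuous_mul_const b) ha fun _ h => M.mul_mem_right _ _ h)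
  have hI : ∀ z, z ∈ I ↔ z ∈ closure (M : Set R) := fun z => mem_mk' ..
  have h1 : (1 : R) ∉ I := by
    rw [hI, Metric.mem_closure_iff]
    intro h
    obtain ⟨b, hb, hlt⟩ := h 1 one_pos
    rw [dist_eq_norm] at hlt
    obtain ⟨u, hu⟩ := isUnit_one_sub_of_norm_lt_one hlt
    rw [sub_sub_cancel] at hu
    apply hM.prop
    have := M.mul_mem_left (↑u⁻¹ : R) b hb
    rwa [← hu, Units.inv_mul] at this
  exact isClosed_of_closure_subset fun z hz =>
    hM.2 h1 (fun w hw => (hI w).2 (subset_closure hw)) ((hI z).2 hz)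

end TwoSidedIdeal

section Character

variable {L : Type*} [CStarAlgebra L]

/-- Modulo a maximal two-sided ideal containing all elements of square zero, every self-adjoint
element is a scalar. -/
theorem exists_sub_algebraMap_mem_of_isSelfAdjoint {M : TwoSidedIdeal L}
    (hM : Maximal (fun I : TwoSidedIdeal L => (1 : L) ∉ I) M)
    (hsq : ∀ v : L, v * v = 0 → v ∈ M) {a : L} (ha : IsSelfAdjoint a) :
    ∃ t : ℝ, a - algebraMap ℝ L t ∈ M := by
  have hcl := TwoSidedIdeal.isClosed_of_maximal hM
  let p : ℝ → L := fun t => cfc (fun x : ℝ => max (x - t) 0) a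
  let q : ℝ → L := fun t => cfc (fun x : ℝ => max (t - x) 0) a
  have hpq : ∀ t, p t - q t = a - algebraMap ℝ L t := by
    intro t
    simp only [p, q]
    rw [← cfc_sub (fun x : ℝ => max (x - t) 0) (fun x : ℝ => max (t - x) 0) a]
    have : (fun x : ℝ => max (x - t) 0 - max (t - x) 0) = fun x => x - t := by
      ext x
      rcases le_total x t with h | h
      · rw [max_eq_right (by linarith), max_eq_left (by linarith)]; ring
      · rw [max_eq_left (by linarith), max_eq_right (by linarith)]; ring
    rw [this, cfc_sub (fun x : ℝ => x) (fun _ => t) a, cfc_id' ℝ a, cfc_const t a]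
  have hqp : ∀ t, q t * p t = 0 := by
    intro t
    simp only [p, q]
    rw [← cfc_mul (fun x : ℝ => max (t - x) 0) (fun x : ℝ => max (x - t) 0) a]
    have : (fun x : ℝ => max (t - x) 0 * max (x - t) 0) = fun _ => 0 := by
      ext x
      rcases le_total x t with h | h
      · rw [max_eq_right (by linarith : x - t ≤ 0), mul_zero]
      · rw [max_eq_right (by linarith : t - x ≤ 0), zero_mul]
    rw [this, cfc_const_zero]
  have hor : ∀ t, p t ∈ M ∨ q t ∈ M := by
    intro t
    refine TwoSidedIdeal.mem_or_mem_of_maximal hM fun l => hsq _ ?_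
    rw [show p t * l * q t * (p t * l * q t) = p t * l * (q t * p t) * l * q t by noncomm_ring,
      hqp]
    simp
  have hpc : Continuous p := by
    refine LipschitzWith.continuous (K := 1) (LipschitzWith.of_dist_le_mul fun s t => ?_)
    simp only [p]
    rw [dist_eq_norm, ← cfc_sub (fun x : ℝ => max (x - s) 0) (fun x : ℝ => max (x - t) 0) a]
    refine norm_cfc_le (by positivity) fun x _ => ?_
    refine (abs_max_sub_max_le_abs _ _ _).trans ?_
    rw [sub_sub_sub_cancel_left, NNReal.coe_one, one_mul, dist_comm, Real.dist_eq]
  have hqc : Continuous q := by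
    refine LipschitzWith.continuous (K := 1) (LipschitzWith.of_dist_le_mul fun s t => ?_)
    simp only [q]
    rw [dist_eq_norm, ← cfc_sub (fun x : ℝ => max (s - x) 0) (fun x : ℝ => max (t - x) 0) a]
    refine norm_cfc_le (by positivity) fun x _ => ?_
    refine (abs_max_sub_max_le_abs _ _ _).trans ?_
    rw [sub_sub_sub_cancel_right, NNReal.coe_one, one_mul, Real.dist_eq]
  have hp0 : p (‖a‖ * ‖(1 : L)‖) ∈ M := by
    have : p (‖a‖ * ‖(1 : L)‖) = cfc (fun _ : ℝ => (0 : ℝ)) a :=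
      cfc_congr fun x hx => max_eq_right <| sub_nonpos.2 <|
        (le_abs_self x).trans (spectrum.norm_le_norm_mul_of_mem hx)
    rw [this, cfc_const_zero]
    exact M.zero_mem
  have hq0 : q (-(‖a‖ * ‖(1 : L)‖)) ∈ M := by
    have : q (-(‖a‖ * ‖(1 : L)‖)) = cfc (fun _ : ℝ => (0 : ℝ)) a :=
      cfc_congr fun x hx => max_eq_right <| by
        have := (neg_abs_le x)
        have h2 := (spectrum.norm_le_norm_mul_of_mem hx)
        rw [Real.norm_eq_abs] at h2
        linarith
    rw [this, cfc_const_zero]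
    exact M.zero_mem
  obtain ⟨t, -, htp, htq⟩ := isPreconnected_closed_iff.1 isPreconnected_univ (p ⁻¹' (M : Set L))
    (q ⁻¹' (M : Set L)) (hcl.preimage hpc) (hcl.preimage hqc) (fun t _ => hor t)
    ⟨_, trivial, hp0⟩ ⟨_, trivial, hq0⟩
  exact ⟨t, hpq t ▸ M.sub_mem htp htq⟩

open ComplexStarModule in
/-- A unital C⋆-algebra has a character killing any given proper two-sided ideal which contains
all elements of square zero. -/
theorem exists_algHom_of_sq_zero_mem (J : TwoSidedIdeal L) (h1 : (1 : L) ∉ J)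
    (hsq : ∀ v : L, v * v = 0 → v ∈ J) : ∃ φ : L →ₐ[ℂ] ℂ, ∀ a ∈ J, φ a = 0 := by
  obtain ⟨M, hJM, hM⟩ := J.exists_le_maximal_one_notMem h1
  have hsa : ∀ {a : L}, IsSelfAdjoint a → ∃ t : ℝ, a - algebraMap ℝ L t ∈ M := fun ha =>
    exists_sub_algebraMap_mem_of_isSelfAdjoint hM (fun v hv => hJM (hsq v hv)) ha
  have hex : ∀ a : L, ∃ z : ℂ, a - algebraMap ℂ L z ∈ M := by
    intro a
    obtain ⟨s, hs⟩ := hsa (realPart a).2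
    obtain ⟨t, ht⟩ := hsa (imaginaryPart a).2
    refine ⟨s + Complex.I * t, ?_⟩
    have := M.add_mem hs (M.mul_mem_left (algebraMap ℂ L Complex.I) _ ht)
    convert this using 1
    conv_lhs => rw [← realPart_add_I_smul_imaginaryPart a]
    simp only [map_add, map_mul, mul_sub, Algebra.smul_def,
      IsScalarTower.algebraMap_apply ℝ ℂ L, Complex.coe_algebraMap]
    abel
  have huniq : ∀ z : ℂ, algebraMap ℂ L z ∈ M → z = 0 := by
    intro z hz
    by_contra hne
    apply hM.prop
    have := M.mul_mem_left (algebraMap ℂ L z⁻¹) _ hz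
    rwa [← map_mul, inv_mul_cancel₀ hne, map_one] at this
  choose φ hφ using hex
  have heq : ∀ {a : L} {z : ℂ}, a - algebraMap ℂ L z ∈ M → φ a = z := by
    intro a z h
    rw [← sub_eq_zero]
    apply huniq
    convert M.sub_mem h (hφ a) using 1
    rw [map_sub]
    abel
  refine ⟨⟨⟨⟨⟨φ, ?_⟩, ?_⟩, ?_, ?_⟩, ?_⟩, ?_⟩
  · exact heq (by simp [M.zero_mem])
  · intro a b
    apply heq
    convert M.add_mem (M.mul_mem_right _ b (hφ a))
      (M.mul_mem_left (algebraMap ℂ L (φ a)) _ (hφ b)) using 1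
    rw [map_mul]
    noncomm_ring
  · exact heq (by simp [M.zero_mem])
  · intro a b
    apply heq
    convert M.add_mem (hφ a) (hφ b) using 1
    rw [map_add]
    abel
  · intro z
    exact heq (by simp [M.zero_mem])
  · intro a ha
    exact heq (by simpa using hJM ha)

end Character

/-- Weak `(2,n)`-divisibility from a family of contractions of square zero indexed by
any finite type. -/
theorem WeaklyTwoDivisible.of_fintype {B : Type*} [CStarAlgebra B] [PartialOrder B]
    [StarOrderedRing B] {ι : Type*} [Fintype ι] (v y : ι → B) (hv : ∀ i, v i * v i = 0)
    (hv1 : ∀ i, ‖v i‖ ≤ 1) (hy : ∀ i, ‖y i‖ ≤ 1)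
    (h : ∑ i, star (y i) * (star (v i) * v i) * y i = 1) :
    WeaklyTwoDivisible B (Fintype.card ι) := by
  let e := (Fintype.equivFin ι).symm
  refine ⟨fun s j => if s = 0 then star (v (e j)) * v (e j) else v (e j) * star (v (e j)),
    fun j => y (e j), ?_, ?_, ?_, fun j => hy _, ?_⟩
  · intro s j
    have := mul_le_one₀ (hv1 (e j)) (norm_nonneg _) (hv1 (e j))
    dsimp only
    split_ifs
    · exact ⟨star_mul_self_nonneg _, by rwa [CStarRing.norm_star_mul_self]⟩
    · exact ⟨mul_star_self_nonneg _, by rwa [CStarRing.norm_self_mul_star]⟩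
  · intro j
    simp only [if_true, one_ne_zero, if_false]
    rw [mul_assoc, ← mul_assoc (v (e j)) (v (e j)), hv, zero_mul, mul_zero]
  · intro j
    exact ⟨star (v (e j)), by simp, by simp⟩
  · simp only [if_true]
    rw [← h]
    exact e.sum_comp (fun i => star (y i) * (star (v i) * v i) * y i)

/-- Splitting each summand into `K` equal pieces removes the norm constraint on the `y i`. -/
theorem WeaklyTwoDivisible.of_norm_sq_le {B : Type*} [CStarAlgebra B] [PartialOrder B]
    [StarOrderedRing B] {ι : Type*} [Fintype ι] (v y : ι → B) (hv : ∀ i, v i * v i = 0)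
    (hv1 : ∀ i, ‖v i‖ ≤ 1) {K : ℕ} (hK : 0 < K) (hy : ∀ i, ‖y i‖ ^ 2 ≤ K)
    (h : ∑ i, star (y i) * (star (v i) * v i) * y i = 1) :
    WeaklyTwoDivisible B (Fintype.card ι * K) := by
  have hK' : (0 : ℝ) < K := by exact_mod_cast hK
  have hs : (√(K : ℝ))⁻¹ * (√(K : ℝ))⁻¹ = (K : ℝ)⁻¹ := by
    rw [← mul_inv, Real.mul_self_sqrt hK'.le]
  have := WeaklyTwoDivisible.of_fintype (ι := ι × Fin K) (fun i => v i.1)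
    (fun i => (√(K : ℝ))⁻¹ • y i.1) (fun i => hv _) (fun i => hv1 _) (fun i => ?_) ?_
  · simpa using this
  · rw [norm_smul, norm_inv, Real.norm_of_nonneg (Real.sqrt_nonneg _),
      inv_mul_le_iff₀ (Real.sqrt_pos.2 hK'), mul_one]
    exact Real.le_sqrt_of_sq_le (hy i.1)
  · rw [Fintype.sum_prod_type, ← h]
    refine Finset.sum_congr rfl fun i _ => ?_
    simp only [star_smul, star_trivial, smul_mul_assoc, mul_smul_comm, smul_smul, hs,
      Finset.sum_const, Finset.card_univ, Fintype.card_fin]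
    rw [← Nat.cast_smul_eq_nsmul ℝ, smul_smul, mul_inv_cancel₀ hK'.ne', one_smul]

/-- If `1` is within `1/2` of a sum `∑ i, x i * v i * y i` with `v i` contractions of square zero,
then the algebra is weakly `(2,n)`-divisible with `n` controlled by the number of summands and
the norms. -/
theorem WeaklyTwoDivisible.of_norm_one_sub_sum_le {B : Type*} [CStarAlgebra B] [PartialOrder B]
    [StarOrderedRing B] {ι : Type*} [Fintype ι] (x v y : ι → B) (hv : ∀ i, v i * v i = 0)
    (hv1 : ∀ i, ‖v i‖ ≤ 1) {C K : ℕ} (hC : 0 < C) (hx : 2 * ∑ i, ‖x i‖ ^ 2 ≤ C) (hK : 0 < K)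
    (hy : ∀ i, ‖y i‖ ^ 2 * (2 * C) ≤ K)
    (h : ‖1 - ∑ i, x i * v i * y i‖ ≤ 1 / 2) :
    WeaklyTwoDivisible B (Fintype.card ι * K) := by
  have hC' : (0 : ℝ) < C := by exact_mod_cast hC
  set s := ∑ i, x i * v i * y i with hs
  set d := ∑ i, star (y i) * (star (v i) * v i) * y i with hd
  have hdsa : IsSelfAdjoint d := by
    rw [hd]
    simp [isSelfAdjoint_iff, star_sum, mul_assoc]
  have h1 : algebraMap ℝ B 1 ≤ s + star s := by
    have hsa : IsSelfAdjoint ((1 - s) + star (1 - s)) := IsSelfAdjoint.add_star_self _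
    have hle := hsa.le_algebraMap_norm_self
    have hn : ‖(1 - s) + star (1 - s)‖ ≤ 1 := by
      refine (norm_add_le _ _).trans ?_
      rw [norm_star]
      linarith
    have := hle.trans (algebraMap_mono B hn)
    rw [map_one] at this ⊢
    rw [← sub_nonneg] at this ⊢
    convert this using 1
    rw [star_sub, star_one]
    abel
  have h2 : (C : ℝ) • (s + star s) ≤ algebraMap ℝ B (∑ i, ‖x i‖ ^ 2) + ((C : ℝ) ^ 2) • d := by
    rw [hs, hd, star_sum, ← Finset.sum_add_distrib, Finset.smul_sum, Finset.smul_sum, map_sum,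
      ← Finset.sum_add_distrib]
    refine Finset.sum_le_sum fun i _ => ?_
    have hxx : x i * star (x i) ≤ algebraMap ℝ B (‖x i‖ ^ 2) := by
      have := (IsSelfAdjoint.mul_star_self (x i)).le_algebraMap_norm_self
      rwa [CStarRing.norm_self_mul_star, ← sq] at this
    have hw := star_mul_self_nonneg (star (x i) - (C : ℝ) • (v i * y i))
    refine le_trans ?_ (add_le_add_left hxx _)
    rw [← sub_nonneg]
    convert hw using 1
    simp only [star_sub, star_star, star_smul, star_trivial, star_mul, sub_mul, mul_sub,
      smul_mul_assoc, mul_smul_comm, smul_add, smul_sub, smul_smul, mul_assoc, sq]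
    abel
  have h3 : algebraMap ℝ B (1 / (2 * C)) ≤ d := by
    have h4 : algebraMap ℝ B (C / 2) ≤ (C : ℝ) ^ 2 • d := by
      have h5 : (C : ℝ) • algebraMap ℝ B 1 ≤
          algebraMap ℝ B (C / 2) + ((C : ℝ) ^ 2) • d :=
        (smul_le_smul_of_nonneg_left h1 hC'.le).trans
          (h2.trans (by gcongr; linarith))
      rw [Algebra.smul_def, ← map_mul, mul_one, ← sub_le_iff_le_add', ← map_sub, sub_half] at h5
      exact h5
    have := smul_le_smul_of_nonneg_left h4 (by positivity : (0 : ℝ) ≤ ((C : ℝ) ^ 2)⁻¹)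
    rw [smul_smul, inv_mul_cancel₀ (by positivity), one_smul, Algebra.smul_def, ← map_mul] at this
    convert this using 2
    field_simp
  have hspec : ∀ t ∈ spectrum ℝ d, 1 / (2 * (C : ℝ)) ≤ t :=
    (algebraMap_le_iff_le_spectrum (a := d)).1 h3
  have hpos : ∀ t ∈ spectrum ℝ d, 0 < t := fun t ht => lt_of_lt_of_le (by positivity) (hspec t ht)
  have hcont : ContinuousOn (fun t : ℝ => (√t)⁻¹) (spectrum ℝ d) :=
    Real.continuous_sqrt.continuousOn.inv₀ fun t ht => (Real.sqrt_pos.2 (hpos t ht)).ne'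
  set r := cfc (fun t : ℝ => (√t)⁻¹) d with hr
  have hrsa : star r = r := (cfc_predicate (fun t : ℝ => (√t)⁻¹) d : IsSelfAdjoint r)
  have hrdr : r * d * r = 1 := by
    have : r * d * r = cfc (fun t : ℝ => (√t)⁻¹ * t * (√t)⁻¹) d := by
      rw [cfc_mul (fun t : ℝ => (√t)⁻¹ * t) _ d (hcont.mul continuousOn_id) hcont,
        cfc_mul _ (fun t : ℝ => t) d hcont continuousOn_id, cfc_id' ℝ d]
    rw [this, ← cfc_const_one ℝ d]
    refine cfc_congr fun t ht => ?_
    have := Real.sqrt_pos.2 (hpos t ht)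
    have h2 := Real.mul_self_sqrt (hpos t ht).le
    field_simp
    linarith
  have hrn : ‖r‖ ≤ √(2 * C) := by
    refine norm_cfc_le (Real.sqrt_nonneg _) fun t ht => ?_
    rw [Real.norm_of_nonneg (inv_nonneg.2 (Real.sqrt_nonneg _)), ← Real.sqrt_inv]
    refine Real.sqrt_le_sqrt ?_
    rw [inv_le_comm₀ (hpos t ht) (by positivity), ← one_div]
    exact hspec t ht
  refine WeaklyTwoDivisible.of_norm_sq_le v (fun i => y i * r) hv hv1 hK (fun i => ?_) ?_
  · calc ‖y i * r‖ ^ 2 ≤ (‖y i‖ * √(2 * C)) ^ 2 := by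
          gcongr
          exact (norm_mul_le _ _).trans (by gcongr)
      _ = ‖y i‖ ^ 2 * (2 * C) := by rw [mul_pow, Real.sq_sqrt (by positivity)]
      _ ≤ K := hy i
  · rw [← hrdr, hd, Finset.mul_sum, Finset.sum_mul]
    refine Finset.sum_congr rfl fun i _ => ?_
    simp only [star_mul, hrsa, mul_assoc]

/-- The `ℓ^∞`-product of nonzero unital C⋆-algebras is a unital C⋆-algebra. -/
noncomputable instance lpInftyCStarAlgebra {I : Type*} (A : I → Type*) [∀ i, CStarAlgebra (A i)]
    [∀ i, Nontrivial (A i)] : CStarAlgebra (lp A ∞) where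

/-- `a` agrees modulo sequences vanishing along `ω` with a finite sum of elements of the form
`x * v * y`, where `v` is a contraction of square zero. -/
def IsSqZeroSumMod {A : ℕ → Type*} [∀ k, CStarAlgebra (A k)] [∀ k, Nontrivial (A k)]
    (ω : Filter ℕ) (a : lp A ∞) : Prop :=
  ∃ (ι : Type) (_ : Fintype ι) (x v y : ι → lp A ∞), (∀ i, v i * v i = 0) ∧ (∀ i, ‖v i‖ ≤ 1) ∧
    Filter.Tendsto (fun k => ‖(a - ∑ i, x i * v i * y i : lp A ∞) k‖) ω (nhds 0)

namespace IsSqZeroSumMod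

variable {A : ℕ → Type*} [∀ k, CStarAlgebra (A k)] [∀ k, Nontrivial (A k)] {ω : Filter ℕ}

theorem of_tendsto {a : lp A ∞}
    (h : Filter.Tendsto (fun k => ‖(a : ∀ k, A k) k‖) ω (nhds 0)) : IsSqZeroSumMod ω a :=
  ⟨Empty, inferInstance, Empty.elim, Empty.elim, Empty.elim, fun i => i.elim, fun i => i.elim,
    by simpa using h⟩

theorem of_sq_zero {v : lp A ∞} (hv : v * v = 0) : IsSqZeroSumMod ω v := by
  refine ⟨Unit, inferInstance, fun _ => algebraMap ℂ _ (‖v‖ : ℂ), fun _ => (‖v‖ : ℂ)⁻¹ • v,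
    fun _ => 1, fun _ => by simp [hv], fun _ => ?_, ?_⟩
  · rw [norm_smul, norm_inv, Complex.norm_real, norm_norm]
    exact inv_mul_le_one
  · have : v - ∑ _i : Unit, algebraMap ℂ (lp A ∞) (‖v‖ : ℂ) * ((‖v‖ : ℂ)⁻¹ • v) * 1 = 0 := by
      rw [Fintype.sum_unique, mul_one, ← Algebra.smul_def, smul_smul]
      by_cases h0 : v = 0
      · simp [h0]
      · rw [mul_inv_cancel₀ (by simpa using h0), one_smul, sub_self]
    simp only [this, lp.coeFn_zero, Pi.zero_apply, norm_zero, tendsto_const_nhds]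

theorem add {a b : lp A ∞} (ha : IsSqZeroSumMod ω a) (hb : IsSqZeroSumMod ω b) :
    IsSqZeroSumMod ω (a + b) := by
  obtain ⟨ι, _, x, v, y, hv, hv1, h⟩ := ha
  obtain ⟨κ, _, x', v', y', hv', hv1', h'⟩ := hb
  refine ⟨ι ⊕ κ, inferInstance, Sum.elim x x', Sum.elim v v', Sum.elim y y',
    Sum.rec hv hv', Sum.rec hv1 hv1', ?_⟩
  refine squeeze_zero (fun _ => norm_nonneg _) (fun k => ?_) (by simpa only [add_zero] using h.add h')
  simp only [Fintype.sum_sum_type, Sum.elim_inl, Sum.elim_inr]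
  rw [add_sub_add_comm]
  exact norm_add_le ((a - ∑ i, x i * v i * y i : lp A ∞) k)
    ((b - ∑ i, x' i * v' i * y' i : lp A ∞) k)

theorem mul_left {a : lp A ∞} (ha : IsSqZeroSumMod ω a) (b : lp A ∞) :
    IsSqZeroSumMod ω (b * a) := by
  obtain ⟨ι, _, x, v, y, hv, hv1, h⟩ := ha
  refine ⟨ι, inferInstance, fun i => b * x i, v, y, hv, hv1, ?_⟩
  refine squeeze_zero (fun _ => norm_nonneg _) (fun k => ?_) (by simpa only [mul_zero] using h.const_mul ‖b‖)
  simp only [mul_assoc b]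
  rw [← Finset.mul_sum, ← mul_sub]
  exact (norm_mul_le _ _).trans (mul_le_mul_of_nonneg_right
    (lp.norm_apply_le_norm ENNReal.top_ne_zero b k) (norm_nonneg _))

theorem mul_right {a : lp A ∞} (ha : IsSqZeroSumMod ω a) (b : lp A ∞) :
    IsSqZeroSumMod ω (a * b) := by
  obtain ⟨ι, _, x, v, y, hv, hv1, h⟩ := ha
  refine ⟨ι, inferInstance, x, v, fun i => y i * b, hv, hv1, ?_⟩
  refine squeeze_zero (fun _ => norm_nonneg _) (fun k => ?_) (by simpa only [zero_mul] using h.mul_const ‖b‖)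
  simp only [← mul_assoc]
  rw [← Finset.sum_mul, ← sub_mul]
  exact (norm_mul_le _ _).trans (mul_le_mul_of_nonneg_left
    (lp.norm_apply_le_norm ENNReal.top_ne_zero b k) (norm_nonneg _))

theorem exists_eventually_divTwo_le [∀ k, PartialOrder (A k)] [∀ k, StarOrderedRing (A k)]
    (h : IsSqZeroSumMod ω (1 : lp A ∞)) : ∃ N : ℕ, ∀ᶠ k in ω, divTwo (A k) ≤ N := by
  obtain ⟨ι, _, x, v, y, hv, hv1, h⟩ := h
  obtain ⟨C, hC⟩ := exists_nat_ge (max 1 (2 * ∑ i, ‖x i‖ ^ 2))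
  obtain ⟨K, hK⟩ := exists_nat_ge (max 1 ((∑ i, ‖y i‖ ^ 2) * (2 * C)))
  rw [max_le_iff] at hC hK
  refine ⟨Fintype.card ι * K, ?_⟩
  filter_upwards [h.eventually_le_const (by norm_num : (0 : ℝ) < 1 / 2)] with k hk
  have hle : ∀ (a : lp A ∞), ‖a k‖ ≤ ‖a‖ := fun a => lp.norm_apply_le_norm ENNReal.top_ne_zero a k
  refine sInf_le ⟨_, WeaklyTwoDivisible.of_norm_one_sub_sum_le (C := C) (K := K)
    (fun i => x i k) (fun i => v i k) (fun i => y i k) (fun i => ?_) (fun i => (hle _).trans (hv1 i))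
    (by exact_mod_cast hC.1) ?_ (by exact_mod_cast hK.1) (fun i => ?_) ?_, rfl⟩
  · exact congrFun (congrArg Subtype.val (hv i)) k
  · refine le_trans ?_ hC.2
    gcongr with i
    exact hle _
  · refine le_trans ?_ hK.2
    gcongr
    refine (pow_le_pow_left₀ (norm_nonneg _) (hle (y i)) 2).trans ?_
    exact Finset.single_le_sum (f := fun i => ‖y i‖ ^ 2) (fun _ _ => by positivity)
      (Finset.mem_univ i)
  · rw [lp.coeFn_sub, Pi.sub_apply, lp.coeFn_sum, Finset.sum_apply] at hk
    exact hk

end IsSqZeroSumMod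

/-- Let `ω` be a free filter on `ℕ` and `(A k)` a sequence of unital
C*-algebras with `limsup_ω div₂(A k) = ∞`.  Then the quotient `∏_ω A_k` of the product
`∏ₖ A_k` (bounded sequences, i.e. `lp A ∞`) by `c_ω({A_k})` has a character; equivalently,
there is a multiplicative state `φ` on `∏ₖ A_k` vanishing on the ideal `c_ω({A_k})` of
sequences whose norms tend to `0` along `ω`. -/
theorem ultraproduct_has_character (A : ℕ → Type*)
    [∀ k, CStarAlgebra (A k)] [∀ k, Nontrivial (A k)]
    [∀ k, PartialOrder (A k)] [∀ k, StarOrderedRing (A k)]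
    (ω : Filter ℕ) [ω.NeBot] (hfree : ω ≤ Filter.cofinite)
    (hdiv : Filter.limsup (fun k => divTwo (A k)) ω = (⊤ : ℕ∞)) :
    ∃ φ : lp A ∞ →L[ℂ] ℂ,
      (‖φ‖ = 1 ∧ ∀ a : lp A ∞, 0 ≤ φ (star a * a)) ∧
      (∀ a b : lp A ∞, φ (a * b) = φ a * φ b) ∧
      (∀ a : lp A ∞,
        Filter.Tendsto (fun k => ‖(a : ∀ k, A k) k‖) ω (nhds 0) → φ a = 0) := by
  have hone : ¬ IsSqZeroSumMod ω (1 : lp A ∞) := by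
    intro h
    obtain ⟨N, hN⟩ := h.exists_eventually_divTwo_le
    have := Filter.limsup_le_of_le (h := hN)
    rw [hdiv, top_le_iff] at this
    exact ENat.natCast_ne_top N this
  let J : TwoSidedIdeal (lp A ∞) := .mk' {a | IsSqZeroSumMod ω a}
    (.of_tendsto (by simp)) (fun ha hb => ha.add hb)
    (fun {a} ha => by simpa using! ha.mul_left (-1)) (fun hb => hb.mul_left _)
    (fun ha => ha.mul_right _)
  have hJ : ∀ a, a ∈ J ↔ IsSqZeroSumMod ω a := fun a => TwoSidedIdeal.mem_mk' ..
  obtain ⟨φ, hφ⟩ := exists_algHom_of_sq_zero_mem J (by rwa [hJ])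
    fun v hv => (hJ v).2 (.of_sq_zero hv)
  have hstar : ∀ a, φ (star a) = star (φ a) := by
    let _ := AlgHomClass.instStarHomClass (F := lp A ∞ →ₐ[ℂ] ℂ) (A := lp A ∞)
    exact map_star φ
  have hnorm : ∀ a, ‖φ a‖ ≤ 1 * ‖a‖ := fun a => by
    rw [one_mul]
    exact AlgHom.norm_apply_le_self φ a
  refine ⟨LinearMap.mkContinuous φ.toLinearMap 1 hnorm, ⟨?_, fun a => ?_⟩, map_mul φ,
    fun a ha => hφ a ((hJ a).2 (.of_tendsto ha))⟩
  · refine le_antisymm (LinearMap.mkContinuous_norm_le _ zero_le_one _) ?_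
    have h1 : ‖φ 1‖ ≤ ‖LinearMap.mkContinuous φ.toLinearMap 1 hnorm‖ * ‖(1 : lp A ∞)‖ :=
      (LinearMap.mkContinuous φ.toLinearMap 1 hnorm).le_opNorm 1
    rwa [map_one, norm_one, norm_one, mul_one] at h1
  · change 0 ≤ φ (star a * a)
    rw [map_mul, hstar]
    exact star_mul_self_nonneg _
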